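/- arXiv:2306.05975 — 2 statements merged into one kernel-verified Lean document; each statement's English description precedes it below -/
import Mathlib

section
/- Let {η1^{(i)}}_{i=0}^{q1} ⊂ [−1,1], {η2^{(i)}}_{i=0}^{q2} ⊂ [−1,1), {η3^{(i)}}_{i=0}^{q3} ⊂ [−1,1) be quadrature nodes with positive weights whose one-dimensional rules are exact of degrees τ1 ≥ 2q1, τ2 ≥ 2q2+1, and τ3 ≥ 2q3+1, respectively, with Lagrange bases ℓ1^{(i)}, ℓ2^{(i)}, ℓ3^{(i)}. Let W be the diagonal matrix with entries W_{α,α} = ((1−η2^{(α2)})(1−η3^{(α3)})²/8) ω1^{(α1)} ω2^{(α2)} ω3^{(α3)} and let Q^{(1)} = W D^{(1)}, where D^{(1)} is the collapsed-coordinate differentiation matrix in the ξ1 direction on the reference tetrahedron. Then for all multi-indices α, β, Q^{(1)}_{α,β} + Q^{(1)}_{β,α} = [ℓ1^{(α1)}(1) ℓ1^{(β1)}(1) − ℓ1^{(α1)}(−1) ℓ1^{(β1)}(−1)] · ∫_{−1}^{1} ℓ2^{(α2)}(s) ℓ2^{(β2)}(s) ds · ∫_{−1}^{1} ((1−s)/2)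 ℓ3^{(α3)}(s) ℓ3^{(β3)}(s) ds. -/
noncomputable section

/-- The collapsed coordinate map from the cube onto the reference tetrahedron. -/
def chi3 (η : ℝ × ℝ × ℝ) : ℝ × ℝ × ℝ :=
  ((1 + η.1) * (1 - η.2.1) * (1 - η.2.2) / 4 - 1,
   (1 + η.2.1) * (1 - η.2.2) / 2 - 1, η.2.2)

/-- Lagrange basis function on the nodes `η`. -/
def lagr {n : ℕ} (η : Fin n → ℝ) (i : Fin n) (x : ℝ) : ℝ :=
  ∏ j ∈ Finset.univ.erase i, (x - η j) / (η i - η j)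

/-- Evaluation of a trivariate polynomial at a point of `ℝ × ℝ × ℝ`. -/
def ev3 (v : MvPolynomial (Fin 3) ℝ) (x : ℝ × ℝ × ℝ) : ℝ :=
  MvPolynomial.eval ![x.1, x.2.1, x.2.2] v

/-- The reference tetrahedron `T̂ = {ξ ∈ [−1,1]³ : ξ1 + ξ2 + ξ3 ≤ −1}`. -/
def refTet : Set (ℝ × ℝ × ℝ) :=
  {ξ | ξ.1 ∈ Set.Icc (-1:ℝ) 1 ∧ ξ.2.1 ∈ Set.Icc (-1:ℝ) 1 ∧ ξ.2.2 ∈ Set.Icc (-1:ℝ) 1 ∧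
    ξ.1 + ξ.2.1 + ξ.2.2 ≤ -1}

/-- A one-dimensional quadrature rule with nodes `η` and weights `ω` is exact of degree `τ`. -/
def exact1D {n : ℕ} (η ω : Fin n → ℝ) (τ : ℕ) : Prop :=
  ∀ f : Polynomial ℝ, f.natDegree ≤ τ →
    ∑ i, ω i * f.eval (η i) = ∫ x in (-1:ℝ)..1, f.eval x

theorem eval_lagrange_basis {n : ℕ} (η : Fin n → ℝ) (i : Fin n) (x : ℝ) :
    (Lagrange.basis Finset.univ η i).eval x = lagr η i x := by
  simp only [Lagrange.basis, Lagrange.basisDivisor, lagr, Polynomial.eval_prod,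
    Polynomial.eval_mul, Polynomial.eval_C, Polynomial.eval_sub, Polynomial.eval_X]
  exact Finset.prod_congr rfl fun j _ => by ring

theorem natDegree_lagrange_basis_le {q : ℕ} (η : Fin (q + 1) → ℝ) (i : Fin (q + 1)) :
    (Lagrange.basis Finset.univ η i).natDegree ≤ q := by
  refine (Polynomial.natDegree_prod_le _ _).trans ?_
  refine (Finset.sum_le_card_nsmul _ _ 1 fun j _ => ?_).trans (by simp)
  exact (Polynomial.natDegree_C_mul_le _ _).trans (Polynomial.natDegree_X_sub_C_le _)

theorem lagr_node {n : ℕ} {η : Fin n → ℝ} (hη : Function.Injective η) (i j : Fin n) :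
    lagr η i (η j) = if i = j then 1 else 0 := by
  unfold lagr
  split_ifs with h
  · subst h
    refine Finset.prod_eq_one fun k hk => div_self ?_
    exact sub_ne_zero.2 (hη.ne (Finset.ne_of_mem_erase hk).symm)
  · exact Finset.prod_eq_zero (Finset.mem_erase.2 ⟨Ne.symm h, Finset.mem_univ j⟩) (by simp)

theorem deriv_lagr {n : ℕ} (η : Fin n → ℝ) (i : Fin n) (x : ℝ) :
    deriv (lagr η i) x = (Lagrange.basis Finset.univ η i).derivative.eval x := by
  rw [← Polynomial.deriv]
  exact congrArg (fun f => deriv f x) (funext fun y => (eval_lagrange_basis η i y).symm)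

/-- The one-dimensional summation-by-parts property. -/
theorem weighted_deriv_lagr_add {q τ : ℕ} {η ω : Fin (q + 1) → ℝ} (hη : Function.Injective η)
    (hτ : 2 * q ≤ τ) (he : exact1D η ω τ) (i j : Fin (q + 1)) :
    ω i * deriv (lagr η j) (η i) + ω j * deriv (lagr η i) (η j) =
      lagr η i 1 * lagr η j 1 - lagr η i (-1) * lagr η j (-1) := by
  have hi := natDegree_lagrange_basis_le η i
  have hj := natDegree_lagrange_basis_le η j
  have hdeg : (Lagrange.basis Finset.univ η i *
      Lagrange.basis Finset.univ η j).derivative.natDegree ≤ τ := by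
    have h1 := Polynomial.natDegree_derivative_le
      (Lagrange.basis Finset.univ η i * Lagrange.basis Finset.univ η j)
    have h2 := Polynomial.natDegree_mul_le (p := Lagrange.basis Finset.univ η i)
      (q := Lagrange.basis Finset.univ η j)
    omega
  have h := he _ hdeg
  rw [intervalIntegral.integral_eq_sub_of_hasDerivAt
    (fun x _ => (Lagrange.basis Finset.univ η i * Lagrange.basis Finset.univ η j).hasDerivAt x)
    ((Polynomial.continuous _).intervalIntegrable _ _)] at h
  simp only [Polynomial.eval_mul, eval_lagrange_basis] at h
  rw [← h]
  simp [Polynomial.derivative_mul, eval_lagrange_basis, ← deriv_lagr, lagr_node hη, mul_add,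
    Finset.sum_add_distrib, add_comm]

theorem integral_poly_mul_lagr_mul_lagr {q τ : ℕ} {η ω : Fin (q + 1) → ℝ}
    (hη : Function.Injective η) (he : exact1D η ω τ) (p : Polynomial ℝ)
    (hτ : 2 * q + p.natDegree ≤ τ) (i j : Fin (q + 1)) :
    ∫ s in (-1:ℝ)..1, p.eval s * (lagr η i s * lagr η j s) =
      if i = j then ω i * p.eval (η i) else 0 := by
  have hi := natDegree_lagrange_basis_le η i
  have hj := natDegree_lagrange_basis_le η j
  have hdeg : (p * (Lagrange.basis Finset.univ η i *
      Lagrange.basis Finset.univ η j)).natDegree ≤ τ := by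
    have h1 := Polynomial.natDegree_mul_le (p := p)
      (q := Lagrange.basis Finset.univ η i * Lagrange.basis Finset.univ η j)
    have h2 := Polynomial.natDegree_mul_le (p := Lagrange.basis Finset.univ η i)
      (q := Lagrange.basis Finset.univ η j)
    omega
  have h := he _ hdeg
  simp only [Polynomial.eval_mul, eval_lagrange_basis, lagr_node hη] at h
  rw [← h]
  by_cases hij : i = j
  · subst hij
    simp
  · simp [hij]

theorem sbp_property_xi1_tetrahedron (q1 q2 q3 τ1 τ2 τ3 : ℕ)
    (η1 ω1 : Fin (q1 + 1) → ℝ) (η2 ω2 : Fin (q2 + 1) → ℝ) (η3 ω3 : Fin (q3 + 1) → ℝ)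
    (hinj1 : Function.Injective η1) (hinj2 : Function.Injective η2)
    (hinj3 : Function.Injective η3)
    (hr1 : ∀ i, η1 i ∈ Set.Icc (-1:ℝ) 1) (hr2 : ∀ i, η2 i ∈ Set.Ico (-1:ℝ) 1)
    (hr3 : ∀ i, η3 i ∈ Set.Ico (-1:ℝ) 1)
    (hw1 : ∀ i, 0 < ω1 i) (hw2 : ∀ i, 0 < ω2 i) (hw3 : ∀ i, 0 < ω3 i)
    (hτ1 : 2 * q1 ≤ τ1) (hτ2 : 2 * q2 + 1 ≤ τ2) (hτ3 : 2 * q3 + 1 ≤ τ3)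
    (he1 : exact1D η1 ω1 τ1) (he2 : exact1D η2 ω2 τ2) (he3 : exact1D η3 ω3 τ3)
    (Q : (Fin (q1 + 1) × Fin (q2 + 1) × Fin (q3 + 1)) →
         (Fin (q1 + 1) × Fin (q2 + 1) × Fin (q3 + 1)) → ℝ)
    (hQ : ∀ a b, Q a b =
      ((1 - η2 a.2.1) * (1 - η3 a.2.2) ^ 2 / 8 * ω1 a.1 * ω2 a.2.1 * ω3 a.2.2) *
        ((4 / ((1 - η2 a.2.1) * (1 - η3 a.2.2))) * deriv (lagr η1 b.1) (η1 a.1) *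
          (if a.2.1 = b.2.1 then (1:ℝ) else 0) * (if a.2.2 = b.2.2 then (1:ℝ) else 0))) :
    ∀ a b, Q a b + Q b a =
      (lagr η1 a.1 1 * lagr η1 b.1 1 - lagr η1 a.1 (-1) * lagr η1 b.1 (-1)) *
        (∫ s in (-1:ℝ)..1, lagr η2 a.2.1 s * lagr η2 b.2.1 s) *
        (∫ s in (-1:ℝ)..1, ((1 - s) / 2) * (lagr η3 a.2.2 s * lagr η3 b.2.2 s)) := by
  intro a b
  have h1 := weighted_deriv_lagr_add hinj1 hτ1 he1 a.1 b.1
  have h2 := integral_poly_mul_lagr_mul_lagr hinj2 he2 1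
    (by rw [Polynomial.natDegree_one]; omega) a.2.1 b.2.1
  have hdeg : (Polynomial.C (1 / 2 : ℝ) * (1 - Polynomial.X)).natDegree ≤ 1 := by
    compute_degree
  have h3 := integral_poly_mul_lagr_mul_lagr hinj3 he3
    (Polynomial.C (1 / 2 : ℝ) * (1 - Polynomial.X)) (by omega) a.2.2 b.2.2
  have hp : ∀ s : ℝ, (Polynomial.C (1 / 2 : ℝ) * (1 - Polynomial.X)).eval s = (1 - s) / 2 := by
    intro s
    simp only [Polynomial.eval_mul, Polynomial.eval_C, Polynomial.eval_sub, Polynomial.eval_one,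
      Polynomial.eval_X]
    ring
  simp only [hp] at h3
  simp only [Polynomial.eval_one, one_mul, mul_one] at h2
  rw [← h1, h2, h3, hQ, hQ]
  by_cases e2 : a.2.1 = b.2.1
  · by_cases e3 : a.2.2 = b.2.2
    · have n2 : 1 - η2 b.2.1 ≠ 0 := (sub_pos.2 (hr2 b.2.1).2).ne'
      have n3 : 1 - η3 b.2.2 ≠ 0 := (sub_pos.2 (hr3 b.2.2).2).ne'
      simp only [e2, e3, if_true]
      field_simp
      ring
    · simp [e3, Ne.symm e3]
  · simp [e2, Ne.symm e2]
end
end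

section
/- Let {η1^{(i)}}_{i=0}^{q1} ⊂ [−1,1], {η2^{(i)}}_{i=0}^{q2} ⊂ [−1,1), {η3^{(i)}}_{i=0}^{q3} ⊂ [−1,1) be quadrature nodes with positive weights whose one-dimensional rules are exact of degrees τ1 ≥ 2q1, τ2 ≥ 2q2+1, and τ3 ≥ 2q3+1, respectively, with Lagrange bases ℓ1^{(i)}, ℓ2^{(i)}, ℓ3^{(i)}. Let W be the diagonal matrix with entries W_{α,α} = ((1−η2^{(α2)})(1−η3^{(α3)})²/8) ω1^{(α1)} ω2^{(α2)} ω3^{(α3)} and let Q^{(2)} = W D^{(2)}, where D^{(2)} is the collapsed-coordinate differentiation matrix in the ξ2 direction on the reference tetrahedron. Then for all multi-indices α, β, Q^{(2)}_{α,β} + Q^{(2)}_{β,α} = ℓ1^{(α1)}(1) ℓ1^{(β1)}(1) ∫_{−1}^{1} ℓ2^{(α2)}(s) ℓ2^{(β2)}(s) ds ∫_{−1}^{1} ((1−s)/2) ℓ3^{(α3)}(s) ℓ3^{(β3)}(s) ds − ℓ2^{(α2)}(−1) ℓ2^{(β2)}(−1) ∫_{−1}^{1} ℓ1^{(α1)}(s)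 ℓ1^{(β1)}(s) ds ∫_{−1}^{1} ((1−s)/2) ℓ3^{(α3)}(s) ℓ3^{(β3)}(s) ds. -/
noncomputable section

open Polynomial in
/-- `lagr` is evaluation of Mathlib's Lagrange basis polynomial. -/
lemma lagr_eq_eval_basis {n : ℕ} (η : Fin n → ℝ) (i : Fin n) :
    lagr η i = fun x => (Lagrange.basis Finset.univ η i).eval x := by
  funext x
  simp only [lagr, Lagrange.basis, Lagrange.basisDivisor, eval_prod, eval_mul, eval_C, eval_sub,
    eval_X]
  exact Finset.prod_congr rfl fun j _ => by rw [div_eq_inv_mul]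

lemma eval_basis_node {n : ℕ} {η : Fin n → ℝ} (hη : Function.Injective η) (i j : Fin n) :
    (Lagrange.basis Finset.univ η i).eval (η j) = if i = j then 1 else 0 := by
  split_ifs with h
  · subst h
    exact Lagrange.eval_basis_self hη.injOn (Finset.mem_univ i)
  · exact Lagrange.eval_basis_of_ne h (Finset.mem_univ j)

lemma natDegree_basis_univ {q : ℕ} {η : Fin (q + 1) → ℝ} (hη : Function.Injective η)
    (i : Fin (q + 1)) : (Lagrange.basis Finset.univ η i).natDegree = q := by
  have h := Lagrange.degree_basis (s := Finset.univ) (v := η) hη.injOn (Finset.mem_univ i)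
  rw [Finset.card_univ, Fintype.card_fin, Nat.add_sub_cancel] at h
  exact Polynomial.natDegree_eq_of_degree_eq_some h

/-- A sufficiently exact quadrature rule gives a diagonal weighted mass matrix. -/
lemma integral_mul_lagr_mul_lagr {q τ : ℕ} {η ω : Fin (q + 1) → ℝ}
    (hη : Function.Injective η) (he : exact1D η ω τ) (g : Polynomial ℝ)
    (hg : g.natDegree + 2 * q ≤ τ) (a b : Fin (q + 1)) :
    ∫ s in (-1:ℝ)..1, g.eval s * (lagr η a s * lagr η b s) =
      if a = b then ω a * g.eval (η a) else 0 := by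
  have h := he (g * (Lagrange.basis Finset.univ η a * Lagrange.basis Finset.univ η b)) (by
    refine Polynomial.natDegree_mul_le.trans ?_
    have := Polynomial.natDegree_mul_le (p := Lagrange.basis Finset.univ η a)
      (q := Lagrange.basis Finset.univ η b)
    rw [natDegree_basis_univ hη, natDegree_basis_univ hη] at this
    lia)
  simp only [Polynomial.eval_mul] at h
  simp only [lagr_eq_eval_basis, ← h, eval_basis_node hη]
  split_ifs with hab
  · subst hab
    simp
  · simp [hab]

/-- Discrete integration by parts for products of Lagrange basis functions with an affine
weight. -/
lemma sum_by_parts_lagr {q τ : ℕ} {η ω : Fin (q + 1) → ℝ}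
    (hη : Function.Injective η) (he : exact1D η ω τ) (g : Polynomial ℝ)
    (hg : g.natDegree ≤ 1) (hτ : 2 * q ≤ τ) (a b : Fin (q + 1)) :
    ω a * g.eval (η a) * deriv (lagr η b) (η a) + ω b * g.eval (η b) * deriv (lagr η a) (η b)
        + (if a = b then ω a * g.derivative.eval (η a) else 0) =
      g.eval 1 * (lagr η a 1 * lagr η b 1) - g.eval (-1) * (lagr η a (-1) * lagr η b (-1)) := by
  set p := g * (Lagrange.basis Finset.univ η a * Lagrange.basis Finset.univ η b) with hp
  have h := he p.derivative (by
    refine (Polynomial.natDegree_derivative_le _).trans ?_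
    have h1 := Polynomial.natDegree_mul_le (p := g)
      (q := Lagrange.basis Finset.univ η a * Lagrange.basis Finset.univ η b)
    have h2 := Polynomial.natDegree_mul_le (p := Lagrange.basis Finset.univ η a)
      (q := Lagrange.basis Finset.univ η b)
    rw [natDegree_basis_univ hη, natDegree_basis_univ hη] at h2
    lia)
  have hftc : ∫ x in (-1:ℝ)..1, p.derivative.eval x = p.eval 1 - p.eval (-1) :=
    intervalIntegral.integral_eq_sub_of_hasDerivAt (fun x _ => p.hasDerivAt x)
      (p.derivative.continuous.intervalIntegrable _ _)
  rw [hftc] at h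
  simp only [lagr_eq_eval_basis, Polynomial.deriv]
  simp only [hp, Polynomial.eval_mul] at h
  rw [← h]
  simp only [Polynomial.derivative_mul, Polynomial.eval_add, Polynomial.eval_mul,
    eval_basis_node hη, mul_add, Finset.sum_add_distrib]
  by_cases hab : a = b
  · subst hab
    simp
    ring
  · simp [hab]
    ring

theorem sbp_property_xi2_tetrahedron (q1 q2 q3 τ1 τ2 τ3 : ℕ)
    (η1 ω1 : Fin (q1 + 1) → ℝ) (η2 ω2 : Fin (q2 + 1) → ℝ) (η3 ω3 : Fin (q3 + 1) → ℝ)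
    (hinj1 : Function.Injective η1) (hinj2 : Function.Injective η2)
    (hinj3 : Function.Injective η3)
    (hr1 : ∀ i, η1 i ∈ Set.Icc (-1:ℝ) 1) (hr2 : ∀ i, η2 i ∈ Set.Ico (-1:ℝ) 1)
    (hr3 : ∀ i, η3 i ∈ Set.Ico (-1:ℝ) 1)
    (hw1 : ∀ i, 0 < ω1 i) (hw2 : ∀ i, 0 < ω2 i) (hw3 : ∀ i, 0 < ω3 i)
    (hτ1 : 2 * q1 ≤ τ1) (hτ2 : 2 * q2 + 1 ≤ τ2) (hτ3 : 2 * q3 + 1 ≤ τ3)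
    (he1 : exact1D η1 ω1 τ1) (he2 : exact1D η2 ω2 τ2) (he3 : exact1D η3 ω3 τ3)
    (Q : (Fin (q1 + 1) × Fin (q2 + 1) × Fin (q3 + 1)) →
         (Fin (q1 + 1) × Fin (q2 + 1) × Fin (q3 + 1)) → ℝ)
    (hQ : ∀ a b, Q a b =
      ((1 - η2 a.2.1) * (1 - η3 a.2.2) ^ 2 / 8 * ω1 a.1 * ω2 a.2.1 * ω3 a.2.2) *
        ((2 * (1 + η1 a.1) / ((1 - η2 a.2.1) * (1 - η3 a.2.2))) *
            deriv (lagr η1 b.1) (η1 a.1) *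
            (if a.2.1 = b.2.1 then (1:ℝ) else 0) * (if a.2.2 = b.2.2 then (1:ℝ) else 0)
          + (2 / (1 - η3 a.2.2)) * (if a.1 = b.1 then (1:ℝ) else 0) *
            deriv (lagr η2 b.2.1) (η2 a.2.1) * (if a.2.2 = b.2.2 then (1:ℝ) else 0))) :
    ∀ a b, Q a b + Q b a =
      lagr η1 a.1 1 * lagr η1 b.1 1 *
          (∫ s in (-1:ℝ)..1, lagr η2 a.2.1 s * lagr η2 b.2.1 s) *
          (∫ s in (-1:ℝ)..1, ((1 - s) / 2) * (lagr η3 a.2.2 s * lagr η3 b.2.2 s))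
        - lagr η2 a.2.1 (-1) * lagr η2 b.2.1 (-1) *
          (∫ s in (-1:ℝ)..1, lagr η1 a.1 s * lagr η1 b.1 s) *
          (∫ s in (-1:ℝ)..1, ((1 - s) / 2) * (lagr η3 a.2.2 s * lagr η3 b.2.2 s)) := by
  intro a b
  obtain ⟨a1, a2, a3⟩ := a
  obtain ⟨b1, b2, b3⟩ := b
  have n2 : ∀ i, 1 - η2 i ≠ 0 := fun i => (sub_pos.2 (hr2 i).2).ne'
  have n3 : ∀ i, 1 - η3 i ≠ 0 := fun i => (sub_pos.2 (hr3 i).2).ne'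
  have m1 := integral_mul_lagr_mul_lagr hinj1 he1 1 (by simpa using hτ1) a1 b1
  have m2 := integral_mul_lagr_mul_lagr hinj2 he2 1 (by simp; lia) a2 b2
  have hdeg : (Polynomial.C (1 / 2 : ℝ) * (1 - Polynomial.X)).natDegree ≤ 1 := by compute_degree
  have m3 := integral_mul_lagr_mul_lagr hinj3 he3
    (Polynomial.C (1 / 2 : ℝ) * (1 - Polynomial.X)) (by lia) a3 b3
  have d1 := sum_by_parts_lagr hinj1 he1 (1 + Polynomial.X) (by compute_degree) hτ1 a1 b1
  have d2 := sum_by_parts_lagr hinj2 he2 (1 - Polynomial.X) (by compute_degree) (by lia) a2 b2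
  simp only [Polynomial.eval_one, one_mul, mul_one] at m1 m2
  simp only [Polynomial.eval_mul, Polynomial.eval_C, Polynomial.eval_sub, Polynomial.eval_one,
    Polynomial.eval_X, one_div_mul_eq_div] at m3
  simp only [Polynomial.eval_add, Polynomial.eval_sub, Polynomial.eval_one, Polynomial.eval_X,
    Polynomial.derivative_add, Polynomial.derivative_sub, Polynomial.derivative_one,
    Polynomial.derivative_X, Polynomial.eval_zero] at d1 d2
  have hQ' : ∀ a b, Q a b =
      (1 - η3 a.2.2) / 4 * ω3 a.2.2 * (if a.2.2 = b.2.2 then (1:ℝ) else 0) *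
        (ω2 a.2.1 * (if a.2.1 = b.2.1 then (1:ℝ) else 0) *
            (ω1 a.1 * (1 + η1 a.1) * deriv (lagr η1 b.1) (η1 a.1)) +
          ω1 a.1 * (if a.1 = b.1 then (1:ℝ) else 0) *
            (ω2 a.2.1 * (1 - η2 a.2.1) * deriv (lagr η2 b.2.1) (η2 a.2.1))) := by
    intro a b
    rw [hQ]
    have := n2 a.2.1
    have := n3 a.2.2
    field_simp
    ring
  simp only [hQ', m1, m2, m3]
  by_cases h3 : a3 = b3
  · subst h3
    simp only [eq_comm (a := b1) (b := a1), eq_comm (a := b2) (b := a2)]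
    by_cases h1 : a1 = b1 <;> by_cases h2 : a2 = b2
    · subst h1 h2
      simp only [if_true] at d1 d2 ⊢
      linear_combination (1 - η3 a3) / 4 * ω3 a3 * (ω2 a2 * d1 + ω1 a1 * d2)
    · subst h1
      simp only [h2, if_true, if_false] at d1 d2 ⊢
      linear_combination (1 - η3 a3) / 4 * ω3 a3 * (ω1 a1 * d2)
    · subst h2
      simp only [h1, if_true, if_false] at d1 d2 ⊢
      linear_combination (1 - η3 a3) / 4 * ω3 a3 * (ω2 a2 * d1)
    · simp only [h1, h2, if_false]
      ring
  · simp [h3, Ne.symm h3]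
end
end
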